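/- Let μ be a Radon measure on ℝⁿ (a Borel measure finite on compact sets), let 1 ≤ p < ∞ and γ > 0, and let f ∈ L¹_loc(ℝⁿ,μ). For Q ∈ 𝒟 set a(f)_Q = ℓ(Q)^{γ/p} (1/μ(Q)) ∫_Q f dμ when μ(Q) > 0 and a(f)_Q = 0 otherwise. Then there is a constant C = C(n,p,γ) such that ∫_{ℝⁿ} |f|ᵖ dμ ≤ C · liminf_{λ→0⁺} λᵖ ∑_{Q∈𝒟 : |a(f)_Q| > λ} ℓ(Q)^{−γ} μ(Q). -/

import Mathlib

open MeasureTheory Set Filter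
open scoped ENNReal Classical Topology

noncomputable section

/-- The half-open dyadic cube in `ℝⁿ` of generation `k` (sidelength `2 ^ k`) and
corner index `j`. -/
def dyadicCube (n : ℕ) (k : ℤ) (j : Fin n → ℤ) : Set (Fin n → ℝ) :=
  Set.univ.pi fun i => Set.Ico ((j i : ℝ) * 2 ^ k) (((j i : ℝ) + 1) * 2 ^ k)

/-- The index of the dyadic cube of generation `k` containing `x`. -/
def dyadicIndex (n : ℕ) (k : ℤ) (x : Fin n → ℝ) : Fin n → ℤ :=
  fun i => ⌊x i / 2 ^ k⌋

theorem mem_dyadicCube_iff {n : ℕ} {k : ℤ} {j : Fin n → ℤ} {x : Fin n → ℝ} :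
    x ∈ dyadicCube n k j ↔ dyadicIndex n k x = j := by
  have h2 : (0 : ℝ) < 2 ^ k := by positivity
  simp only [dyadicCube, Set.mem_univ_pi, Set.mem_Ico, dyadicIndex, funext_iff, Int.floor_eq_iff,
    le_div_iff₀ h2, div_lt_iff₀ h2]

theorem dyadicCube_eq_preimage (n : ℕ) (k : ℤ) (j : Fin n → ℤ) :
    dyadicCube n k j = dyadicIndex n k ⁻¹' {j} := by
  ext x
  exact mem_dyadicCube_iff

theorem mem_dyadicCube_dyadicIndex {n : ℕ} (k : ℤ) (x : Fin n → ℝ) :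
    x ∈ dyadicCube n k (dyadicIndex n k x) :=
  mem_dyadicCube_iff.2 rfl

theorem measurable_dyadicIndex (n : ℕ) (k : ℤ) : Measurable (dyadicIndex n k) :=
  measurable_pi_lambda _ fun i => Int.measurable_floor.comp ((measurable_pi_apply i).div_const _)

theorem measurableSet_dyadicCube (n : ℕ) (k : ℤ) (j : Fin n → ℤ) :
    MeasurableSet (dyadicCube n k j) :=
  MeasurableSet.univ_pi fun _ => measurableSet_Ico

theorem dyadicIndex_succ {n : ℕ} (k : ℤ) (x : Fin n → ℝ) :
    dyadicIndex n (k + 1) x = fun i => dyadicIndex n k x i / 2 := by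
  funext i
  have h : x i / 2 ^ (k + 1) = x i / 2 ^ k / ((2 : ℕ) : ℝ) := by
    rw [zpow_add₀ two_ne_zero, zpow_one, div_div, Nat.cast_ofNat]
  rw [dyadicIndex, h, Int.floor_div_natCast]
  rfl

theorem dyadicIndex_add_eq_of_eq {n : ℕ} {k : ℤ} {x y : Fin n → ℝ} (m : ℕ)
    (h : dyadicIndex n k x = dyadicIndex n k y) :
    dyadicIndex n (k + m) x = dyadicIndex n (k + m) y := by
  induction m with
  | zero => simpa using h
  | succ m ih =>
    rw [Nat.cast_succ, ← add_assoc, dyadicIndex_succ, dyadicIndex_succ, ih]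

theorem dyadicCube_subset_unit {n : ℕ} (m : ℕ) (x : Fin n → ℝ) :
    dyadicCube n (-m) (dyadicIndex n (-m) x) ⊆ dyadicCube n 0 (dyadicIndex n 0 x) := by
  intro y hy
  rw [mem_dyadicCube_iff] at hy ⊢
  simpa using dyadicIndex_add_eq_of_eq m hy

/-- The filtration of `ℝⁿ` whose `m`-th `σ`-algebra is generated by the dyadic cubes of
generation `-m`. -/
def dyadicFiltration (n : ℕ) :
    Filtration ℕ (inferInstance : MeasurableSpace (Fin n → ℝ)) where
  seq m := MeasurableSpace.comap (dyadicIndex n (-m)) ⊤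
  mono' := by
    refine monotone_nat_of_le_succ fun m => ?_
    have h : dyadicIndex n (-m) =
        (fun v i => v i / 2) ∘ dyadicIndex n (-((m + 1 : ℕ) : ℤ)) := by
      funext x
      have := dyadicIndex_succ (-((m + 1 : ℕ) : ℤ)) x
      rw [show -((m + 1 : ℕ) : ℤ) + 1 = -m by push_cast; ring] at this
      exact this
    rw [h, ← MeasurableSpace.comap_comp]
    exact MeasurableSpace.comap_mono le_top
  le' m := by
    rintro s ⟨t, -, rfl⟩
    exact measurable_dyadicIndex n _ (Set.to_countable t).measurableSet

theorem tendsto_dyadicIndex_mul {n : ℕ} (x : Fin n → ℝ) (i : Fin n) :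
    Tendsto (fun m : ℕ => (dyadicIndex n (-m) x i : ℝ) * 2 ^ (-(m : ℤ))) atTop (𝓝 (x i)) := by
  have h0 : Tendsto (fun m : ℕ => (2 : ℝ) ^ (-(m : ℤ))) atTop (𝓝 0) := by
    simpa [zpow_neg] using tendsto_pow_atTop_nhds_zero_of_lt_one (r := (2 : ℝ)⁻¹)
      (by norm_num) (by norm_num)
  have h1 : Tendsto (fun m : ℕ => x i - (2 : ℝ) ^ (-(m : ℤ))) atTop (𝓝 (x i)) := by
    simpa using h0.const_sub (x i)
  have hmem : ∀ m : ℕ, (dyadicIndex n (-m) x i : ℝ) * 2 ^ (-(m : ℤ)) ≤ x i ∧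
      x i < ((dyadicIndex n (-m) x i : ℝ) + 1) * 2 ^ (-(m : ℤ)) := fun m =>
    mem_dyadicCube_dyadicIndex (-(m : ℤ)) x i (Set.mem_univ i)
  refine tendsto_of_tendsto_of_tendsto_of_le_of_le h1 tendsto_const_nhds (fun m => ?_)
    fun m => (hmem m).1
  have := (hmem m).2
  simp only
  linarith

theorem iSup_dyadicFiltration (n : ℕ) :
    ⨆ m, dyadicFiltration n m = (inferInstance : MeasurableSpace (Fin n → ℝ)) := by
  refine le_antisymm (iSup_le fun m => (dyadicFiltration n).le m) ?_
  have h : Measurable[⨆ m, dyadicFiltration n m] (id : (Fin n → ℝ) → (Fin n → ℝ)) := by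
    refine @measurable_pi_lambda _ _ _ (_) _ _ fun i => ?_
    refine @measurable_of_tendsto_metrizable _ _ (_) _ _ _ _
      (fun (m : ℕ) x => (dyadicIndex n (-m) x i : ℝ) * 2 ^ (-(m : ℤ))) _ (fun m => ?_)
      (tendsto_pi_nhds.2 fun x => tendsto_dyadicIndex_mul x i)
    have h1 : Measurable[dyadicFiltration n m]
        (fun x => (dyadicIndex n (-m) x i : ℝ) * 2 ^ (-(m : ℤ))) := by
      intro s _
      exact ⟨(fun v : Fin n → ℤ => (v i : ℝ) * 2 ^ (-(m : ℤ))) ⁻¹' s, trivial, rfl⟩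
    exact h1.mono (le_iSup (fun m => dyadicFiltration n m) m) le_rfl
  intro s hs
  exact h hs

theorem ae_measure_dyadicCube_ne_zero {n : ℕ} (μ : Measure (Fin n → ℝ)) (k : ℤ) :
    ∀ᵐ x ∂μ, μ (dyadicCube n k (dyadicIndex n k x)) ≠ 0 := by
  have h : ∀ᵐ x ∂μ, ∀ j : Fin n → ℤ, μ (dyadicCube n k j) = 0 → x ∉ dyadicCube n k j := by
    refine ae_all_iff.2 fun j => ?_
    by_cases hj : μ (dyadicCube n k j) = 0
    · filter_upwards [measure_eq_zero_iff_ae_notMem.1 hj] with x hx _ using hx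
    · exact Eventually.of_forall fun x h => absurd h hj
  filter_upwards [h] with x hx h0 using hx _ h0 (mem_dyadicCube_dyadicIndex k x)

theorem ae_condExp_dyadicFiltration_eq {n : ℕ} (μ : Measure (Fin n → ℝ)) [IsFiniteMeasure μ]
    {f : (Fin n → ℝ) → ℝ} (hf : Integrable f μ) (m : ℕ) :
    ∀ᵐ x ∂μ, (μ[f | dyadicFiltration n m]) x =
      ⨍ y in dyadicCube n (-m) (dyadicIndex n (-m) x), f y ∂μ := by
  filter_upwards [ae_measure_dyadicCube_ne_zero μ (-m)] with x hx
  set Q := dyadicCube n (-m) (dyadicIndex n (-m) x)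
  set g := μ[f | dyadicFiltration n m]
  have hQm : MeasurableSet[dyadicFiltration n m] Q :=
    ⟨{dyadicIndex n (-m) x}, trivial, (dyadicCube_eq_preimage _ _ _).symm⟩
  have hconst : ∀ y ∈ Q, g y = g x := by
    intro y hy
    have hgm : Measurable[dyadicFiltration n m] g := stronglyMeasurable_condExp.measurable
    obtain ⟨t, -, ht⟩ := hgm (measurableSet_singleton (g x))
    have hxt : x ∈ dyadicIndex n (-m) ⁻¹' t := by rw [ht]; rfl
    have hyt : y ∈ dyadicIndex n (-m) ⁻¹' t := by
      rw [Set.mem_preimage, mem_dyadicCube_iff.1 hy]; exact hxt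
    rw [ht] at hyt
    exact hyt
  have hint : ∫ y in Q, f y ∂μ = μ.real Q * g x := by
    rw [← setIntegral_condExp ((dyadicFiltration n).le m) hf hQm,
      setIntegral_congr_fun (measurableSet_dyadicCube _ _ _) hconst,
      setIntegral_const, smul_eq_mul]
  have hQ0 : μ.real Q ≠ 0 := (measureReal_ne_zero_iff).2 hx
  rw [setAverage_eq, hint, smul_eq_mul, inv_mul_cancel_left₀ hQ0]

theorem ae_tendsto_setAverage_dyadicCube_of_integrable {n : ℕ} (μ : Measure (Fin n → ℝ))
    [IsFiniteMeasure μ] {f : (Fin n → ℝ) → ℝ} (hf : Integrable f μ) :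
    ∀ᵐ x ∂μ, Tendsto
      (fun m : ℕ => ⨍ y in dyadicCube n (-m) (dyadicIndex n (-m) x), f y ∂μ)
      atTop (𝓝 (f x)) := by
  have hlim := tendsto_ae_condExp (μ := μ) (ℱ := dyadicFiltration n) f
  rw [iSup_dyadicFiltration] at hlim
  filter_upwards [hlim, condExp_of_aestronglyMeasurable' le_rfl hf.aestronglyMeasurable hf,
    ae_all_iff.2 (ae_condExp_dyadicFiltration_eq μ hf)] with x h1 h2 h3
  rw [h2] at h1
  exact h1.congr h3

theorem dyadicCube_subset_Icc (n : ℕ) (k : ℤ) (j : Fin n → ℤ) :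
    dyadicCube n k j ⊆ Set.Icc (fun i => (j i : ℝ) * 2 ^ k) (fun i => ((j i : ℝ) + 1) * 2 ^ k) :=
  fun _ hx => ⟨fun i => (hx i (Set.mem_univ i)).1, fun i => (hx i (Set.mem_univ i)).2.le⟩

/-- Lebesgue's differentiation theorem along dyadic cubes, for Radon measures. -/
theorem ae_tendsto_setAverage_dyadicCube {n : ℕ} (μ : Measure (Fin n → ℝ))
    [IsFiniteMeasureOnCompacts μ] {f : (Fin n → ℝ) → ℝ} (hf : LocallyIntegrable f μ) :
    ∀ᵐ x ∂μ, Tendsto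
      (fun m : ℕ => ⨍ y in dyadicCube n (-m) (dyadicIndex n (-m) x), f y ∂μ)
      atTop (𝓝 (f x)) := by
  have h : ∀ᵐ x ∂μ, ∀ j : Fin n → ℤ, x ∈ dyadicCube n 0 j → Tendsto
      (fun m : ℕ => ⨍ y in dyadicCube n (-m) (dyadicIndex n (-m) x), f y
        ∂(μ.restrict (dyadicCube n 0 j))) atTop (𝓝 (f x)) := by
    refine ae_all_iff.2 fun j => ?_
    rw [← ae_restrict_iff' (measurableSet_dyadicCube _ _ _)]
    have hsub := dyadicCube_subset_Icc n 0 j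
    have : IsFiniteMeasure (μ.restrict (dyadicCube n 0 j)) :=
      isFiniteMeasure_restrict.2 ((measure_mono hsub).trans_lt isCompact_Icc.measure_lt_top).ne
    exact ae_tendsto_setAverage_dyadicCube_of_integrable _
      ((hf.integrableOn_isCompact isCompact_Icc).mono_set hsub)
  filter_upwards [h] with x hx
  refine (hx _ (mem_dyadicCube_dyadicIndex 0 x)).congr fun m => ?_
  rw [Measure.restrict_restrict (measurableSet_dyadicCube _ _ _),
    Set.inter_eq_left.2 (dyadicCube_subset_unit m x)]

/-- Fatou's lemma along a countably generated filter. -/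
theorem lintegral_le_liminf_of_ae_eventually_le {α ι : Type*} [MeasurableSpace α] {μ : Measure α}
    {l : Filter ι} [l.IsCountablyGenerated] {g : α → ℝ≥0∞} {F : ι → α → ℝ≥0∞}
    (hF : ∀ i, Measurable (F i)) (h : ∀ᵐ x ∂μ, ∀ᶠ i in l, g x ≤ F i x) :
    ∫⁻ x, g x ∂μ ≤ liminf (fun i => ∫⁻ x, F i x ∂μ) l := by
  by_contra! hlt
  obtain ⟨b, hb1, hb2⟩ := exists_between hlt
  have hfreq : ∃ᶠ i in l, ∫⁻ x, F i x ∂μ < b := frequently_lt_of_liminf_lt (by isBoundedDefault) hb1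
  obtain ⟨u, hu, hub⟩ := exists_seq_forall_of_frequently hfreq
  have h1 : ∫⁻ x, g x ∂μ ≤ ∫⁻ x, liminf (fun k => F (u k) x) atTop ∂μ := by
    refine lintegral_mono_ae ?_
    filter_upwards [h] with x hx
    exact le_liminf_of_le (by isBoundedDefault) (hu.eventually hx)
  have h2 : ∫⁻ x, liminf (fun k => F (u k) x) atTop ∂μ ≤ b :=
    (lintegral_liminf_le fun k => hF (u k)).trans <|
      (liminf_le_liminf (Eventually.of_forall fun k => (hub k).le)).trans (by simp)
  exact absurd (h1.trans h2) (not_le.2 hb2)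

theorem eventually_exists_rpow_le {p γ : ℝ} (hp : 1 ≤ p) (hγ : 0 < γ) {c : ℤ → ℝ} {y : ℝ}
    (hy : y ≠ 0) (hc : Tendsto (fun m : ℕ => c (-m)) atTop (𝓝 y)) :
    ∀ᶠ l in 𝓝[>] (0 : ℝ), ∃ k : ℤ, l < |((2 : ℝ) ^ k) ^ (γ / p) * c k| ∧
      |y| ^ p ≤ 2 ^ (p + γ) * (l ^ p * ((2 : ℝ) ^ k) ^ (-γ)) := by
  have hp0 : 0 < p := by linarith
  have hy0 : 0 < |y| := abs_pos.2 hy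
  obtain ⟨M, hM⟩ := eventually_atTop.1 (hc.abs.eventually_const_lt (half_lt_self hy0))
  set t : ℝ := 2 ^ (γ / p) with ht
  have ht1 : 1 < t := Real.one_lt_rpow one_lt_two (by positivity)
  have ht0 : 0 < t := by linarith
  have htk : ∀ k : ℤ, ((2 : ℝ) ^ k) ^ (γ / p) = t ^ k := fun k => by
    rw [ht, ← Real.rpow_intCast, ← Real.rpow_intCast, ← Real.rpow_mul two_pos.le,
      ← Real.rpow_mul two_pos.le, mul_comm]
  have hsmall : ∀ᶠ l in 𝓝[>] (0 : ℝ), l < t ^ (-(M : ℤ) - 1) * (|y| / 2) :=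
    eventually_nhdsWithin_of_eventually_nhds (eventually_lt_nhds (by positivity))
  filter_upwards [hsmall, self_mem_nhdsWithin] with l hl hl0
  have hl0 : 0 < l := hl0
  obtain ⟨r, hr1, hr2⟩ := exists_mem_Ico_zpow (x := l / (|y| / 2)) (by positivity) ht1
  have hrM : r < -(M : ℤ) - 1 :=
    (zpow_lt_zpow_iff_right₀ ht1).1 (hr1.trans_lt ((div_lt_iff₀ (by positivity)).2 hl))
  obtain ⟨m, hm⟩ : ∃ m : ℕ, r + 1 = -(m : ℤ) := ⟨(-(r + 1)).toNat, by omega⟩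
  have hMm : M ≤ m := by omega
  refine ⟨r + 1, ?_, ?_⟩
  · rw [htk, abs_mul, abs_of_pos (zpow_pos ht0 _)]
    have h1 := hM m hMm
    rw [← hm] at h1
    exact ((div_lt_iff₀ (by positivity)).1 hr2).trans
      (mul_lt_mul_of_pos_left h1 (zpow_pos ht0 _))
  · have h2 : |y| ≤ 2 * t * (l * (t ^ (r + 1))⁻¹) := by
      rw [le_div_iff₀ (by positivity)] at hr1
      rw [zpow_add_one₀ ht0.ne']
      have : 2 * t * (l * (t ^ r * t)⁻¹) = 2 * l / t ^ r := by
        field_simp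
      rw [this, le_div_iff₀ (zpow_pos ht0 _)]
      linarith
    have htp : t ^ p = 2 ^ γ := by
      rw [ht, ← Real.rpow_mul two_pos.le, div_mul_cancel₀ _ hp0.ne']
    have h3 : (t ^ (r + 1))⁻¹ ^ p = ((2 : ℝ) ^ (r + 1)) ^ (-γ) := by
      have h2r : (0 : ℝ) < 2 ^ (r + 1) := by positivity
      rw [← htk, ← Real.rpow_neg h2r.le, ← Real.rpow_mul h2r.le, neg_mul,
        div_mul_cancel₀ _ hp0.ne']
    calc |y| ^ p ≤ (2 * t * (l * (t ^ (r + 1))⁻¹)) ^ p :=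
          Real.rpow_le_rpow hy0.le h2 hp0.le
      _ = 2 ^ (p + γ) * (l ^ p * ((2 : ℝ) ^ (r + 1)) ^ (-γ)) := by
          rw [Real.mul_rpow (by positivity) (by positivity), Real.mul_rpow (by positivity) ht0.le,
            Real.mul_rpow hl0.le (by positivity), htp, h3, Real.rpow_add two_pos]

/-- for a Radon measure `μ`, `1 ≤ p < ∞`, `γ > 0` and `f ∈ L¹_loc(μ)`, with
`a(f)_Q = ℓ(Q)^{γ/p} ⨍_Q f dμ` (which is `0` when `μ(Q) = 0`), one has
`∫ |f|^p dμ ≤ C liminf_{λ→0⁺} λ^p ∑_{|a(f)_Q|>λ} ℓ(Q)^{-γ} μ(Q)`. -/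
theorem statement13 (n : ℕ) (p γ : ℝ) (hp : 1 ≤ p) (hγ : 0 < γ) :
    ∃ C : ℝ, 0 < C ∧
      ∀ (μ : Measure (Fin n → ℝ)), IsFiniteMeasureOnCompacts μ →
      ∀ f : (Fin n → ℝ) → ℝ, LocallyIntegrable f μ →
      (∫⁻ x, ENNReal.ofReal (|f x| ^ p) ∂μ)
        ≤ ENNReal.ofReal C *
          Filter.liminf
            (fun l : ℝ => ENNReal.ofReal (l ^ p) *
              ∑' Q : ℤ × (Fin n → ℤ),
                if l < |((2 : ℝ) ^ Q.1) ^ (γ / p) * ⨍ x in dyadicCube n Q.1 Q.2, f x ∂μ| then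
                  ENNReal.ofReal (((2 : ℝ) ^ Q.1) ^ (-γ)) * μ (dyadicCube n Q.1 Q.2) else 0)
            (𝓝[>] (0 : ℝ)) := by
  have hp0 : 0 < p := by linarith
  have hK : (0 : ℝ) < 2 ^ (p + γ) := by positivity
  refine ⟨2 ^ (p + γ), hK, fun μ hμ f hf => ?_⟩
  set w : ℝ → ℤ × (Fin n → ℤ) → ℝ≥0∞ := fun l Q =>
    if l < |((2 : ℝ) ^ Q.1) ^ (γ / p) * ⨍ x in dyadicCube n Q.1 Q.2, f x ∂μ| then
      ENNReal.ofReal (((2 : ℝ) ^ Q.1) ^ (-γ)) else 0 with hw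
  set F : ℝ → (Fin n → ℝ) → ℝ≥0∞ := fun l x => ENNReal.ofReal (2 ^ (p + γ)) *
    (ENNReal.ofReal (l ^ p) *
      ∑' Q : ℤ × (Fin n → ℤ), (dyadicCube n Q.1 Q.2).indicator (fun _ => w l Q) x) with hFdef
  have hind : ∀ l (Q : ℤ × (Fin n → ℤ)),
      Measurable ((dyadicCube n Q.1 Q.2).indicator fun _ => w l Q) := fun l Q =>
    measurable_const.indicator (measurableSet_dyadicCube _ _ _)
  have hsum : ∀ l, Measurable fun x => ∑' Q : ℤ × (Fin n → ℤ),
      (dyadicCube n Q.1 Q.2).indicator (fun _ => w l Q) x := fun l =>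
    Measurable.tsum (hind l)
  have hFm : ∀ l, Measurable (F l) := fun l => ((hsum l).const_mul _).const_mul _
  have hFint : ∀ l, ∫⁻ x, F l x ∂μ = ENNReal.ofReal (2 ^ (p + γ)) * (ENNReal.ofReal (l ^ p) *
      ∑' Q : ℤ × (Fin n → ℤ),
        if l < |((2 : ℝ) ^ Q.1) ^ (γ / p) * ⨍ x in dyadicCube n Q.1 Q.2, f x ∂μ| then
          ENNReal.ofReal (((2 : ℝ) ^ Q.1) ^ (-γ)) * μ (dyadicCube n Q.1 Q.2) else 0) := by
    intro l
    rw [hFdef]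
    simp only
    rw [lintegral_const_mul _ ((hsum l).const_mul _), lintegral_const_mul _ (hsum l),
      lintegral_tsum fun Q => (hind l Q).aemeasurable]
    congr 3
    funext Q
    rw [lintegral_indicator_const (measurableSet_dyadicCube _ _ _), hw]
    simp only [ite_mul, zero_mul]
  rw [← ENNReal.liminf_const_mul_of_ne_top ENNReal.ofReal_ne_top]
  simp_rw [← hFint]
  refine lintegral_le_liminf_of_ae_eventually_le hFm ?_
  filter_upwards [ae_tendsto_setAverage_dyadicCube μ hf] with x hx
  rcases eq_or_ne (f x) 0 with h0 | h0
  · simp [h0, Real.zero_rpow hp0.ne']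
  filter_upwards [eventually_exists_rpow_le hp hγ
    (c := fun k => ⨍ y in dyadicCube n k (dyadicIndex n k x), f y ∂μ) h0 hx,
    self_mem_nhdsWithin] with l hl hl0
  have hl0 : 0 < l := hl0
  obtain ⟨k, hk1, hk2⟩ := hl
  calc ENNReal.ofReal (|f x| ^ p)
      ≤ ENNReal.ofReal (2 ^ (p + γ) * (l ^ p * ((2 : ℝ) ^ k) ^ (-γ))) :=
        ENNReal.ofReal_le_ofReal hk2
    _ = ENNReal.ofReal (2 ^ (p + γ)) * (ENNReal.ofReal (l ^ p) *
          (dyadicCube n k (dyadicIndex n k x)).indicator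
            (fun _ => w l (k, dyadicIndex n k x)) x) := by
        rw [ENNReal.ofReal_mul hK.le, ENNReal.ofReal_mul (by positivity),
          Set.indicator_of_mem (mem_dyadicCube_dyadicIndex k x), hw]
        simp only [if_pos hk1]
    _ ≤ F l x := by
        refine mul_le_mul_right (mul_le_mul_right ?_ _) _
        exact ENNReal.le_tsum (f := fun Q : ℤ × (Fin n → ℤ) =>
          (dyadicCube n Q.1 Q.2).indicator (fun _ => w l Q) x) (k, dyadicIndex n k x)
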